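/- Let L(n, j) denote the number of matchings on [2n] with exactly j left-nestings, and let T : ℕ × ℕ → ℤ be any function satisfying T(1,1) = 1, T(n,k) = 0 whenever n < k, T(n,0) = 0 for all n ≥ 1, and T(n,k) = k·T(n-1,k) + (2n-k)·T(n-1,k-1) for all n ≥ 2 and k ≥ 1 (so T is the second-order Eulerian triangle). Then for all n ≥ 1 and 1 ≤ k ≤ n, L(n, n-k) = T(n, k); that is, the distribution of left-nestings over all matchings on [2n] is given by the second-order Eulerian triangle. (This resolves a conjecture of Claesson and Linusson.) -/

import Mathlib

/-- A matching on `[2n] = {1, …, 2n}`: a finite set of pairs `(a, b)` with `a < b`,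
whose endpoints are exactly `{1, …, 2n}`, with all endpoints pairwise distinct. -/
def IsMatching (n : ℕ) (X : Finset (ℕ × ℕ)) : Prop :=
  (∀ p ∈ X, p.1 < p.2) ∧
  (∀ i : ℕ, (1 ≤ i ∧ i ≤ 2 * n) ↔ ∃ p ∈ X, i = p.1 ∨ i = p.2) ∧
  (∀ p ∈ X, ∀ q ∈ X, p ≠ q → p.1 ≠ q.1 ∧ p.1 ≠ q.2 ∧ p.2 ≠ q.1 ∧ p.2 ≠ q.2)

/-- The number of left-nestings of `X`: pairs of pairs `(a,b), (c,d) ∈ X` with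
`a < c < d < b` and `c = a + 1`. -/
def numLeftNestings (X : Finset (ℕ × ℕ)) : ℕ :=
  ((X ×ˢ X).filter fun pq => pq.2.1 = pq.1.1 + 1 ∧ pq.2.1 < pq.2.2 ∧ pq.2.2 < pq.1.2).card

/-- `L n j`: the number of matchings on `[2n]` with exactly `j` left-nestings. -/
noncomputable def L (n j : ℕ) : ℕ :=
  {X : Finset (ℕ × ℕ) | IsMatching n X ∧ numLeftNestings X = j}.ncard

open Finset

namespace IsMatching

variable {n : ℕ} {X : Finset (ℕ × ℕ)}

theorem bounds (hX : IsMatching n X) {p : ℕ × ℕ} (hp : p ∈ X) :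
    1 ≤ p.1 ∧ p.1 < p.2 ∧ p.2 ≤ 2 * n :=
  ⟨((hX.2.1 p.1).2 ⟨p, hp, Or.inl rfl⟩).1, hX.1 p hp, ((hX.2.1 p.2).2 ⟨p, hp, Or.inr rfl⟩).2⟩

theorem eq_of_fst_eq (hX : IsMatching n X) {p q : ℕ × ℕ} (hp : p ∈ X) (hq : q ∈ X)
    (h : p.1 = q.1) : p = q := by
  by_contra hne
  exact (hX.2.2 p hp q hq hne).1 h

theorem eq_of_snd_eq (hX : IsMatching n X) {p q : ℕ × ℕ} (hp : p ∈ X) (hq : q ∈ X)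
    (h : p.2 = q.2) : p = q := by
  by_contra hne
  exact (hX.2.2 p hp q hq hne).2.2.2 h

theorem fst_ne_snd (hX : IsMatching n X) {p q : ℕ × ℕ} (hp : p ∈ X) (hq : q ∈ X) :
    p.1 ≠ q.2 := by
  rcases eq_or_ne p q with rfl | hne
  · exact (hX.1 p hp).ne
  · exact (hX.2.2 p hp q hq hne).2.1

theorem card_eq (hX : IsMatching n X) : #X = n := by
  have hunion : Icc 1 (2 * n) = X.image Prod.fst ∪ X.image Prod.snd := by
    ext i
    rw [mem_Icc, hX.2.1 i]
    simp only [mem_union, mem_image]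
    constructor
    · rintro ⟨p, hp, h | h⟩
      · exact Or.inl ⟨p, hp, h.symm⟩
      · exact Or.inr ⟨p, hp, h.symm⟩
    · rintro (⟨p, hp, h⟩ | ⟨p, hp, h⟩)
      · exact ⟨p, hp, Or.inl h.symm⟩
      · exact ⟨p, hp, Or.inr h.symm⟩
  have hdisj : Disjoint (X.image Prod.fst) (X.image Prod.snd) := by
    simp only [disjoint_left, mem_image]
    rintro _ ⟨p, hp, rfl⟩ ⟨q, hq, h⟩
    exact hX.fst_ne_snd hp hq h.symm
  have hcard := congrArg card hunion
  rw [card_union_of_disjoint hdisj, Nat.card_Icc,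
    card_image_of_injOn fun p hp q hq h => hX.eq_of_fst_eq hp hq h,
    card_image_of_injOn fun p hp q hq h => hX.eq_of_snd_eq hp hq h] at hcard
  omega

end IsMatching

/-- The arcs of `X` that are the inner arc of a left-nesting. -/
def innerArcs (X : Finset (ℕ × ℕ)) : Finset (ℕ × ℕ) :=
  X.filter fun p => ∃ q ∈ X, q.1 + 1 = p.1 ∧ p.2 < q.2

theorem innerArcs_subset (X : Finset (ℕ × ℕ)) : innerArcs X ⊆ X := filter_subset _ _

theorem IsMatching.numLeftNestings_eq {n : ℕ} {X : Finset (ℕ × ℕ)} (hX : IsMatching n X) :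
    numLeftNestings X = #(innerArcs X) := by
  refine card_bij (fun pq _ => pq.2) ?_ ?_ ?_
  · rintro ⟨p, q⟩ h
    simp only [mem_filter, mem_product] at h
    exact mem_filter.2 ⟨h.1.2, p, h.1.1, h.2.1.symm, h.2.2.2⟩
  · rintro ⟨p, q⟩ h ⟨p', q'⟩ h' heq
    simp only [mem_filter, mem_product] at h h' heq
    subst heq
    rw [hX.eq_of_fst_eq h.1.1 h'.1.1 (by omega)]
  · intro q hq
    obtain ⟨hq, p, hp, h⟩ := mem_filter.1 hq
    exact ⟨(p, q), by simpa using ⟨⟨hp, hq⟩, h.1.symm, hX.1 q hq, h.2⟩, rfl⟩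

/-- Renumbering of the points that makes room for a new point `a`. -/
def gapShift (a i : ℕ) : ℕ := if i < a then i else i + 1

theorem gapShift_strictMono (a : ℕ) : StrictMono (gapShift a) := by
  intro i j h
  unfold gapShift
  split_ifs <;> omega

theorem gapShift_ne (a i : ℕ) : gapShift a i ≠ a := by
  unfold gapShift
  split_ifs <;> omega

theorem exists_gapShift_eq {a i : ℕ} (h : i ≠ a) : ∃ j, gapShift a j = i := by
  rcases lt_or_gt_of_ne h with h | h
  · exact ⟨i, if_pos h⟩
  · exact ⟨i - 1, by unfold gapShift; split_ifs <;> omega⟩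

/-- `gapShift` on both endpoints of an arc. -/
def arcShift (a : ℕ) (p : ℕ × ℕ) : ℕ × ℕ := (gapShift a p.1, gapShift a p.2)

theorem arcShift_injective (a : ℕ) : Function.Injective (arcShift a) := by
  intro p q h
  have h1 := (gapShift_strictMono a).injective (congrArg Prod.fst h)
  have h2 := (gapShift_strictMono a).injective (congrArg Prod.snd h)
  exact Prod.ext h1 h2

/-- Insert into a matching on `[2m]` an arc from the new point `a` to the new last point. -/
def insertArc (m a : ℕ) (X : Finset (ℕ × ℕ)) : Finset (ℕ × ℕ) :=
  insert (a, 2 * m + 2) (X.image (arcShift a))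

theorem mem_insertArc {m a : ℕ} {X : Finset (ℕ × ℕ)} {p : ℕ × ℕ} :
    p ∈ insertArc m a X ↔ p = (a, 2 * m + 2) ∨ ∃ q ∈ X, arcShift a q = p := by
  simp [insertArc]

section

variable {m a : ℕ} {X : Finset (ℕ × ℕ)}

theorem IsMatching.arcShift_bounds (hX : IsMatching m X) {p : ℕ × ℕ} (hp : p ∈ X) :
    1 ≤ (arcShift a p).1 ∧ (arcShift a p).1 < (arcShift a p).2 ∧
      (arcShift a p).2 < 2 * m + 2 := by
  have := hX.bounds hp
  refine ⟨?_, gapShift_strictMono a this.2.1, ?_⟩ <;>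
    simp only [arcShift, gapShift] <;> split_ifs <;> omega

theorem IsMatching.isMatching_insertArc (hX : IsMatching m X) (ha : a ∈ Icc 1 (2 * m + 1)) :
    IsMatching (m + 1) (insertArc m a X) := by
  rw [mem_Icc] at ha
  refine ⟨?_, ?_, ?_⟩
  · intro p hp
    rcases mem_insertArc.1 hp with rfl | ⟨q, hq, rfl⟩
    · show a < 2 * m + 2
      omega
    · exact (hX.arcShift_bounds hq).2.1
  · intro i
    constructor
    · intro hi
      rcases eq_or_ne i (2 * m + 2) with rfl | h
      · exact ⟨_, mem_insertArc.2 (Or.inl rfl), Or.inr rfl⟩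
      rcases eq_or_ne i a with rfl | h'
      · exact ⟨_, mem_insertArc.2 (Or.inl rfl), Or.inl rfl⟩
      obtain ⟨j, rfl⟩ := exists_gapShift_eq h'
      have hj : 1 ≤ j ∧ j ≤ 2 * m := by
        unfold gapShift at hi h
        split_ifs at hi h <;> omega
      obtain ⟨p, hp, hpj⟩ := (hX.2.1 j).1 hj
      refine ⟨_, mem_insertArc.2 (Or.inr ⟨p, hp, rfl⟩), ?_⟩
      rcases hpj with rfl | rfl
      · exact Or.inl rfl
      · exact Or.inr rfl
    · rintro ⟨p, hp, hi⟩
      rcases mem_insertArc.1 hp with rfl | ⟨q, hq, rfl⟩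
      · simp only at hi
        omega
      · have := hX.arcShift_bounds (a := a) hq
        omega
  · have new : ∀ q ∈ X, (arcShift a q).1 ≠ a ∧ (arcShift a q).1 ≠ 2 * m + 2 ∧
        (arcShift a q).2 ≠ a ∧ (arcShift a q).2 ≠ 2 * m + 2 := by
      intro q hq
      have := hX.arcShift_bounds (a := a) hq
      exact ⟨gapShift_ne _ _, by omega, gapShift_ne _ _, by omega⟩
    intro p hp q hq hne
    rcases mem_insertArc.1 hp with rfl | ⟨p, hpX, rfl⟩ <;>
      rcases mem_insertArc.1 hq with rfl | ⟨q, hqX, rfl⟩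
    · exact absurd rfl hne
    · have := new q hqX
      exact ⟨this.1.symm, this.2.2.1.symm, this.2.1.symm, this.2.2.2.symm⟩
    · have := new p hpX
      exact ⟨this.1, this.2.1, this.2.2.1, this.2.2.2⟩
    · have := hX.2.2 p hpX q hqX (fun h => hne (h ▸ rfl))
      have inj := (gapShift_strictMono a).injective
      exact ⟨inj.ne this.1, inj.ne this.2.1, inj.ne this.2.2.1, inj.ne this.2.2.2⟩

theorem insertArc_inj {a' : ℕ} {X' : Finset (ℕ × ℕ)} (hX : IsMatching m X)
    (hX' : IsMatching m X') (h : insertArc m a X = insertArc m a' X') : a = a' ∧ X = X' := by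
  have ha : a = a' := by
    have hmem : (a, 2 * m + 2) ∈ insertArc m a' X' := h ▸ mem_insertArc.2 (Or.inl rfl)
    rcases mem_insertArc.1 hmem with h | ⟨q, hq, h⟩
    · exact congrArg Prod.fst h
    · have := hX'.arcShift_bounds (a := a') hq
      rw [h] at this
      simp at this
  subst ha
  have aux : ∀ {Y Z : Finset (ℕ × ℕ)}, IsMatching m Y →
      insertArc m a Y = insertArc m a Z → Y ⊆ Z := by
    intro Y Z hY heq p hp
    have hmem : arcShift a p ∈ insertArc m a Z := heq ▸ mem_insertArc.2 (Or.inr ⟨p, hp, rfl⟩)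
    rcases mem_insertArc.1 hmem with h | ⟨q, hq, h⟩
    · have := hY.arcShift_bounds (a := a) hp
      rw [h] at this
      simp at this
    · exact arcShift_injective a h ▸ hq
  exact ⟨rfl, (aux hX h).antisymm (aux hX' h.symm)⟩

theorem IsMatching.exists_insertArc {Y : Finset (ℕ × ℕ)} (hY : IsMatching (m + 1) Y) :
    ∃ a ∈ Icc 1 (2 * m + 1), ∃ X, IsMatching m X ∧ insertArc m a X = Y := by
  obtain ⟨⟨a, b⟩, hab, hlast⟩ := (hY.2.1 (2 * m + 2)).1 ⟨by omega, by omega⟩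
  have hbd := hY.bounds hab
  obtain rfl : b = 2 * m + 2 := by
    simp only at hlast hbd
    omega
  simp only at hbd
  have other : ∀ p ∈ Y, p ≠ (a, 2 * m + 2) → ∃ q, arcShift a q = p := by
    intro p hp hne
    have := hY.2.2 p hp _ hab hne
    obtain ⟨i, hi⟩ := exists_gapShift_eq this.1
    obtain ⟨j, hj⟩ := exists_gapShift_eq this.2.2.1
    exact ⟨(i, j), Prod.ext hi hj⟩
  have hmem : ∀ q, q ∈ Y.preimage (arcShift a) (arcShift_injective a).injOn ↔
      arcShift a q ∈ Y := fun q => mem_preimage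
  refine ⟨a, mem_Icc.2 ⟨hbd.1, by omega⟩, Y.preimage (arcShift a) (arcShift_injective a).injOn,
    ⟨?_, ?_, ?_⟩, ?_⟩
  · intro p hp
    exact (gapShift_strictMono a).lt_iff_lt.1 (hY.1 _ ((hmem p).1 hp))
  · intro i
    constructor
    · intro hi
      have hi' : 1 ≤ gapShift a i ∧ gapShift a i ≤ 2 * (m + 1) := by
        unfold gapShift
        split_ifs <;> omega
      obtain ⟨p, hp, hpi⟩ := (hY.2.1 _).1 hi'
      have hne : p ≠ (a, 2 * m + 2) := by
        rintro rfl
        rcases hpi with h | h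
        · exact gapShift_ne _ _ h
        · unfold gapShift at h
          split_ifs at h <;> simp only at h <;> omega
      obtain ⟨q, rfl⟩ := other p hp hne
      refine ⟨q, (hmem q).2 hp, ?_⟩
      exact hpi.imp (fun h => (gapShift_strictMono a).injective h)
        (fun h => (gapShift_strictMono a).injective h)
    · rintro ⟨p, hp, hpi⟩
      rw [hmem] at hp
      have hb := hY.bounds hp
      have hne : (arcShift a p).2 ≠ 2 * m + 2 := fun h =>
        gapShift_ne a p.1 (congrArg Prod.fst (hY.eq_of_snd_eq hp hab h))
      simp only [arcShift, gapShift] at hb hne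
      split_ifs at hb hne <;> omega
  · intro p hp q hq hne
    have := hY.2.2 _ ((hmem p).1 hp) _ ((hmem q).1 hq) ((arcShift_injective a).ne hne)
    exact ⟨ne_of_apply_ne (gapShift a) this.1, ne_of_apply_ne (gapShift a) this.2.1,
      ne_of_apply_ne (gapShift a) this.2.2.1, ne_of_apply_ne (gapShift a) this.2.2.2⟩
  · ext p
    rw [mem_insertArc]
    constructor
    · rintro (rfl | ⟨q, hq, rfl⟩)
      · exact hab
      · exact (hmem q).1 hq
    · intro hp
      by_cases hne : p = (a, 2 * m + 2)
      · exact Or.inl hne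
      · obtain ⟨q, rfl⟩ := other p hp hne
        exact Or.inr ⟨q, (hmem q).2 hp, rfl⟩

theorem IsMatching.innerArcs_insertArc (hX : IsMatching m X) :
    innerArcs (insertArc m a X) =
      (innerArcs X ∪ X.filter fun p => p.1 = a).image (arcShift a) := by
  ext p
  simp only [innerArcs, mem_filter, mem_image, mem_union, mem_insertArc]
  constructor
  · rintro ⟨rfl | ⟨p, hp, rfl⟩, q, hq, h1, h2⟩
    · rcases hq with rfl | ⟨q, hq, rfl⟩
      · exact absurd h2 (lt_irrefl _)
      · exact absurd h2 (hX.arcShift_bounds hq).2.2.le.not_gt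
    · refine ⟨p, ?_, rfl⟩
      by_cases hpa : p.1 = a
      · exact Or.inr ⟨hp, hpa⟩
      rcases hq with rfl | ⟨q, hq, rfl⟩
      · simp only [arcShift, gapShift] at h1
        split_ifs at h1 <;> omega
      · refine Or.inl ⟨hp, q, hq, ?_, (gapShift_strictMono a).lt_iff_lt.1 h2⟩
        simp only [arcShift, gapShift] at h1
        split_ifs at h1 <;> omega
  · rintro ⟨p, hp, rfl⟩
    by_cases hpa : p.1 = a
    · have hpX : p ∈ X := hp.elim And.left And.left
      refine ⟨Or.inr ⟨p, hpX, rfl⟩, _, Or.inl rfl, ?_, (hX.arcShift_bounds hpX).2.2⟩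
      simp [arcShift, gapShift, hpa]
    · rcases hp with ⟨hp, q, hq, h1, h2⟩ | ⟨-, h⟩
      · refine ⟨Or.inr ⟨p, hp, rfl⟩, _, Or.inr ⟨q, hq, rfl⟩, ?_, gapShift_strictMono a h2⟩
        simp only [arcShift, gapShift]
        split_ifs <;> omega
      · exact absurd h hpa

theorem IsMatching.numLeftNestings_insertArc (hX : IsMatching m X)
    (ha : a ∈ Icc 1 (2 * m + 1)) :
    numLeftNestings (insertArc m a X) =
      numLeftNestings X + if a ∈ (X \ innerArcs X).image Prod.fst then 1 else 0 := by
  rw [(hX.isMatching_insertArc ha).numLeftNestings_eq, hX.numLeftNestings_eq, hX.innerArcs_insertArc,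
    card_image_of_injective _ (arcShift_injective a)]
  split_ifs with h
  · obtain ⟨p, hp, rfl⟩ := mem_image.1 h
    rw [mem_sdiff] at hp
    have : (X.filter fun q => q.1 = p.1) = {p} := by
      ext q
      simp only [mem_filter, mem_singleton]
      constructor
      · exact fun hq => hX.eq_of_fst_eq hq.1 hp.1 hq.2
      · rintro rfl
        exact ⟨hp.1, rfl⟩
    rw [this, card_union_of_disjoint (disjoint_singleton_right.2 hp.2), card_singleton]
  · rw [union_eq_left.2, add_zero]
    intro p hp
    rw [mem_filter] at hp
    by_contra hpD
    exact h (mem_image.2 ⟨p, mem_sdiff.2 ⟨hp.1, hpD⟩, hp.2⟩)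

theorem IsMatching.card_image_sdiff_innerArcs (hX : IsMatching m X) :
    #((X \ innerArcs X).image Prod.fst) = m - numLeftNestings X := by
  rw [card_image_of_injOn, card_sdiff_of_subset (innerArcs_subset X), hX.card_eq,
    hX.numLeftNestings_eq]
  intro p hp q hq h
  exact hX.eq_of_fst_eq (mem_sdiff.1 hp).1 (mem_sdiff.1 hq).1 h

theorem IsMatching.card_insertions (hX : IsMatching m X) (j : ℕ) :
    #((Icc 1 (2 * m + 1)).filter fun a => numLeftNestings (insertArc m a X) = j) =
      (if numLeftNestings X = j then m + 1 + j else 0) +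
        if numLeftNestings X + 1 = j then m + 1 - j else 0 := by
  set U := (X \ innerArcs X).image Prod.fst with hU
  have hUcard : #U = m - numLeftNestings X := hX.card_image_sdiff_innerArcs
  have hle : numLeftNestings X ≤ m := by
    rw [hX.numLeftNestings_eq, ← hX.card_eq]
    exact card_le_card (innerArcs_subset X)
  have hUsub : U ⊆ Icc 1 (2 * m + 1) := by
    intro a ha
    obtain ⟨p, hp, rfl⟩ := mem_image.1 ha
    have := hX.bounds (mem_sdiff.1 hp).1
    exact mem_Icc.2 ⟨this.1, by omega⟩
  have hfilter : ((Icc 1 (2 * m + 1)).filter fun a =>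
      numLeftNestings (insertArc m a X) = j) =
      (Icc 1 (2 * m + 1)).filter fun a => numLeftNestings X + (if a ∈ U then 1 else 0) = j :=
    filter_congr fun a ha => by rw [hX.numLeftNestings_insertArc ha]
  rw [hfilter]
  rcases eq_or_ne (numLeftNestings X) j with h | h
  · rw [if_pos h, if_neg (by omega)]
    have : ((Icc 1 (2 * m + 1)).filter fun a =>
        numLeftNestings X + (if a ∈ U then 1 else 0) = j) = Icc 1 (2 * m + 1) \ U := by
      ext a
      rw [mem_filter, mem_sdiff]
      split_ifs with haU <;> simp [haU, h]
    rw [this, card_sdiff_of_subset hUsub, hUcard, Nat.card_Icc]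
    omega
  · rw [if_neg h, zero_add]
    split_ifs with h'
    · have : ((Icc 1 (2 * m + 1)).filter fun a =>
          numLeftNestings X + (if a ∈ U then 1 else 0) = j) = U := by
        ext a
        rw [mem_filter]
        split_ifs with haU
        · simp [haU, h', mem_Icc.1 (hUsub haU)]
        · simp [haU, h]
      rw [this, hUcard]
      omega
    · rw [card_eq_zero, filter_eq_empty_iff]
      intro a _
      split_ifs <;> omega

end

open Classical in
/-- The finite set of all matchings on `[2n]`. -/
noncomputable def matchings (n : ℕ) : Finset (Finset (ℕ × ℕ)) :=
  (Icc 1 (2 * n) ×ˢ Icc 1 (2 * n)).powerset.filter (IsMatching n)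

theorem mem_matchings {n : ℕ} {X : Finset (ℕ × ℕ)} : X ∈ matchings n ↔ IsMatching n X := by
  simp only [matchings, mem_filter, mem_powerset, and_iff_right_iff_imp]
  intro hX p hp
  have := hX.bounds hp
  simp only [mem_product, mem_Icc]
  omega

theorem L_eq_card (n j : ℕ) : L n j = #((matchings n).filter (numLeftNestings · = j)) := by
  rw [L, ← Set.ncard_coe_finset]
  congr 1
  ext X
  simp [mem_matchings]

theorem L_succ_eq_sum (m j : ℕ) : L (m + 1) j = ∑ X ∈ matchings m,
    #((Icc 1 (2 * m + 1)).filter fun a => numLeftNestings (insertArc m a X) = j) := by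
  rw [L_eq_card, ← card_sigma]
  symm
  refine card_bij (fun x _ => insertArc m x.2 x.1) ?_ ?_ ?_
  · rintro ⟨X, a⟩ h
    simp only [mem_sigma, mem_filter, mem_matchings] at h ⊢
    exact ⟨h.1.isMatching_insertArc h.2.1, h.2.2⟩
  · rintro ⟨X, a⟩ h ⟨X', a'⟩ h' heq
    simp only [mem_sigma, mem_matchings] at h h'
    obtain ⟨rfl, rfl⟩ := insertArc_inj h.1 h'.1 heq
    rfl
  · intro Y hY
    rw [mem_filter, mem_matchings] at hY
    obtain ⟨a, ha, X, hX, rfl⟩ := hY.1.exists_insertArc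
    exact ⟨⟨X, a⟩, by simpa only [mem_sigma, mem_filter, mem_matchings] using ⟨hX, ha, hY.2⟩, rfl⟩

theorem L_succ (m j : ℕ) : L (m + 1) j = (m + 1 + j) * L m j +
    (m + 1 - j) * #((matchings m).filter (numLeftNestings · + 1 = j)) := by
  rw [L_succ_eq_sum, sum_congr rfl fun X hX => (mem_matchings.1 hX).card_insertions j,
    sum_add_distrib, ← sum_filter, ← sum_filter, sum_const, sum_const, ← L_eq_card]
  simp only [smul_eq_mul, mul_comm]

theorem L_succ_zero (m : ℕ) : L (m + 1) 0 = (m + 1) * L m 0 := by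
  simp [L_succ]

theorem L_succ_succ (m j : ℕ) :
    L (m + 1) (j + 1) = (m + j + 2) * L m (j + 1) + (m - j) * L m j := by
  rw [L_succ, L_eq_card m j, Nat.add_sub_add_right, show m + 1 + (j + 1) = m + j + 2 by ring]
  simp only [Nat.add_right_cancel_iff]

theorem isMatching_zero {X : Finset (ℕ × ℕ)} : IsMatching 0 X ↔ X = ∅ := by
  constructor
  · intro hX
    exact card_eq_zero.1 hX.card_eq
  · rintro rfl
    refine ⟨by simp, fun i => ?_, by simp⟩
    simp only [notMem_empty, false_and, exists_false, iff_false]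
    omega

theorem matchings_zero : matchings 0 = {∅} := by
  ext X
  rw [mem_matchings, isMatching_zero, mem_singleton]

theorem L_zero (j : ℕ) : L 0 j = if j = 0 then 1 else 0 := by
  rw [L_eq_card, matchings_zero, filter_singleton]
  have : numLeftNestings ∅ = 0 := rfl
  rw [this]
  split_ifs <;> first | rfl | omega

theorem L_eq_zero {n j : ℕ} (hj : 1 ≤ j) (h : n ≤ j) : L n j = 0 := by
  induction n generalizing j with
  | zero => rw [L_zero, if_neg (by omega)]
  | succ m ih =>
    obtain ⟨i, rfl⟩ : ∃ i, j = i + 1 := ⟨j - 1, by omega⟩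
    rw [L_succ_succ, ih (by omega) (by omega), Nat.sub_eq_zero_of_le (by omega)]
    simp

/-- The distribution of left-nestings over all matchings on `[2n]` is given by the
second-order Eulerian triangle (OEIS A008517): if `T` satisfies `T(1,1) = 1`,
`T(n,k) = 0` for `n < k`, `T(n,0) = 0` for `n ≥ 1`, and
`T(n,k) = k·T(n-1,k) + (2n-k)·T(n-1,k-1)` for `n ≥ 2`, `k ≥ 1`, then
`L(n, n-k) = T(n,k)` for all `1 ≤ k ≤ n`.  (Conjecture of Claesson and Linusson.) -/
theorem left_nesting_distribution_second_order_eulerian (T : ℕ → ℕ → ℤ)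
    (hT1 : T 1 1 = 1)
    (hT0 : ∀ n k : ℕ, n < k → T n k = 0)
    (hTz : ∀ n : ℕ, 1 ≤ n → T n 0 = 0)
    (hTrec : ∀ n k : ℕ, 2 ≤ n → 1 ≤ k →
      T n k = (k : ℤ) * T (n - 1) k + (2 * (n : ℤ) - k) * T (n - 1) (k - 1)) :
    ∀ n k : ℕ, 1 ≤ n → 1 ≤ k → k ≤ n → (L n (n - k) : ℤ) = T n k := by
  intro n k hn
  induction n, hn using Nat.le_induction generalizing k with
  | base =>
    intro hk hk'
    obtain rfl : k = 1 := by omega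
    rw [hT1, Nat.sub_self, L_succ_zero, L_zero]
    rfl
  | succ n hn ih =>
    intro hk hkn
    rw [hTrec (n + 1) k (by omega) hk, Nat.add_sub_cancel]
    have hprev : T n (k - 1) = L n (n + 1 - k) := by
      rcases Nat.eq_or_lt_of_le hk with rfl | hk1
      · rw [hTz n hn, Nat.add_sub_cancel, L_eq_zero hn le_rfl, Nat.cast_zero]
      · rw [← ih (k - 1) (by omega) (by omega), show n - (k - 1) = n + 1 - k by omega]
    rw [hprev]
    rcases Nat.eq_or_lt_of_le hkn with rfl | hlt
    · rw [hT0 n (n + 1) (by omega), Nat.sub_self, L_succ_zero]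
      push_cast
      ring
    · obtain ⟨j, rfl⟩ : ∃ j, n = k + j := ⟨n - k, by omega⟩
      rw [← ih k hk (by omega), show k + j + 1 - k = j + 1 by omega, Nat.add_sub_cancel_left,
        L_succ_succ, Nat.add_sub_cancel]
      push_cast
      ring
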